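/- arXiv:1409.5868 — 4 statements merged into one kernel-verified Lean document; each statement's English description precedes it below -/
import Mathlib

section
/- Let n ≥ 2, m = ⌊n/2⌋, and let w be a permutation of {1,…,n} satisfying the spacing condition. If ℓ(w) = m² in case n = 2m, or ℓ(w) = m² + m in case n = 2m+1, then w(n) = w(1) − 1. -/
noncomputable section

/-- `stdE n j` is the span `E_j` of the first `j` standard basis vectors of `ℂ^n`. -/
def stdE (n j : ℕ) : Submodule ℂ (Fin n → ℂ) :=
  Submodule.span ℂ ((fun i : Fin n => (Pi.single i 1 : Fin n → ℂ)) '' {i : Fin n | (i : ℕ) < j})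

/-- The number of inversions (length `ℓ(w)`) of a permutation of `{1,…,n}`. -/
def invCount (n : ℕ) (w : Equiv.Perm (Fin n)) : ℕ :=
  (Finset.univ.filter (fun p : Fin n × Fin n => p.1 < p.2 ∧ w p.2 < w p.1)).card

/-- The image `τ(V)` of a complex subspace `V ⊆ ℂ^n` under coordinatewise complex
conjugation (equivalently, its preimage, since conjugation is an involution). -/
def conjSubmodule (n : ℕ) (V : Submodule ℂ (Fin n → ℂ)) : Submodule ℂ (Fin n → ℂ) where
  carrier := {x | (fun i => (starRingEnd ℂ) (x i)) ∈ V}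
  add_mem' := by
    intro a b ha hb
    simp only [Set.mem_setOf_eq] at *
    have h : (fun i => (starRingEnd ℂ) ((a + b) i))
        = (fun i => (starRingEnd ℂ) (a i)) + fun i => (starRingEnd ℂ) (b i) := by
      funext i; simp
    rw [h]; exact V.add_mem ha hb
  zero_mem' := by
    simp only [Set.mem_setOf_eq]
    have h : (fun i => (starRingEnd ℂ) ((0 : Fin n → ℂ) i)) = (0 : Fin n → ℂ) := by
      funext i; simp
    rw [h]; exact V.zero_mem
  smul_mem' := by
    intro c x hx
    simp only [Set.mem_setOf_eq] at *
    have h : (fun i => (starRingEnd ℂ) ((c • x) i))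
        = (starRingEnd ℂ) c • fun i => (starRingEnd ℂ) (x i) := by
      funext i; simp
    rw [h]; exact V.smul_mem _ hx

/-- The orthogonal complement `V^⊥` of a subspace of `ℂ^n` with respect to the standard
symmetric bilinear form `b(v,w) = Σ v i * w i`. -/
def bOrtho (n : ℕ) (V : Submodule ℂ (Fin n → ℂ)) : Submodule ℂ (Fin n → ℂ) where
  carrier := {x | ∀ v ∈ V, ∑ i, x i * v i = 0}
  add_mem' := by
    intro a b ha hb v hv
    simp only [Pi.add_apply, add_mul]
    rw [Finset.sum_add_distrib, ha v hv, hb v hv, add_zero]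
  zero_mem' := by intro v hv; simp
  smul_mem' := by
    intro c x hx v hv
    simp only [Pi.smul_apply, smul_eq_mul, mul_assoc]
    rw [← Finset.mul_sum, hx v hv, mul_zero]

/-- A complete flag `0 = V_0 ⊂ V_1 ⊂ ⋯ ⊂ V_n = ℂ^n` in `ℂ^n`, with `dim V_i = i`. -/
structure CompleteFlag (n : ℕ) where
  V : Fin (n + 1) → Submodule ℂ (Fin n → ℂ)
  mono : Monotone V
  dim : ∀ i : Fin (n + 1), Module.finrank ℂ (V i) = (i : ℕ)

/-- Membership of a complete flag in the Schubert variety `S_w`: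
`dim (V_i ∩ E_j) ≥ #{a : 1 ≤ a ≤ i, w(a) ≤ j}` for all `1 ≤ i, j ≤ n`. -/
def InSchubert (n : ℕ) (w : Equiv.Perm (Fin n)) (F : CompleteFlag n) : Prop :=
  ∀ i j : ℕ, 1 ≤ i → i ≤ n → 1 ≤ j → j ≤ n → ∀ hi : i < n + 1,
    (Finset.univ.filter (fun a : Fin n => (a : ℕ) < i ∧ ((w a : ℕ)) < j)).card
      ≤ Module.finrank ℂ ↥(F.V ⟨i, hi⟩ ⊓ stdE n j)

/-- A complete flag is `τ`-generic if `τ(V_j) ⊕ V_{n-j} = ℂ^n` for all `1 ≤ j ≤ ⌊n/2⌋`. -/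
def TauGeneric (n : ℕ) (F : CompleteFlag n) : Prop :=
  ∀ j : ℕ, 1 ≤ j → j ≤ n / 2 → ∀ (h1 : j < n + 1) (h2 : n - j < n + 1),
    IsCompl (conjSubmodule n (F.V ⟨j, h1⟩)) (F.V ⟨n - j, h2⟩)

/-- A complete flag is isotropic if `V_{n-i} = (V_i)^⊥` for all `1 ≤ i ≤ ⌊n/2⌋`. -/
def IsotropicFlag (n : ℕ) (F : CompleteFlag n) : Prop :=
  ∀ i : ℕ, 1 ≤ i → i ≤ n / 2 → ∀ (h1 : n - i < n + 1) (h2 : i < n + 1),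
    F.V ⟨n - i, h1⟩ = bOrtho n (F.V ⟨i, h2⟩)

/-- The spacing condition: `w(n+1-i) < w(i)` for all `1 ≤ i ≤ ⌊n/2⌋` (one-line notation,
positions and values written here `0`-based via `Fin n`). -/
def Spacing (n : ℕ) (w : Equiv.Perm (Fin n)) : Prop :=
  ∀ i : ℕ, 1 ≤ i → i ≤ n / 2 → ∀ (h1 : n - i < n) (h2 : i - 1 < n),
    (w ⟨n - i, h1⟩ : Fin n) < w ⟨i - 1, h2⟩

/-- The double box contraction condition: for every `1 ≤ i ≤ ⌊n/2⌋`, `w(n+1-i) < w(i)` and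
every value `x` strictly between `w(n+1-i)` and `w(i)` equals `w(a)` or `w(n+1-a)` for some
`1 ≤ a ≤ i-1`. -/
def DoubleBox (n : ℕ) (w : Equiv.Perm (Fin n)) : Prop :=
  ∀ i : ℕ, 1 ≤ i → i ≤ n / 2 → ∀ (h1 : n - i < n) (h2 : i - 1 < n),
    (w ⟨n - i, h1⟩ : ℕ) < (w ⟨i - 1, h2⟩ : ℕ) ∧
    ∀ x : ℕ, (w ⟨n - i, h1⟩ : ℕ) < x → x < (w ⟨i - 1, h2⟩ : ℕ) →
      ∃ a : ℕ, 1 ≤ a ∧ a ≤ i - 1 ∧ ∀ (ha1 : a - 1 < n) (ha2 : n - a < n),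
        x = (w ⟨a - 1, ha1⟩ : ℕ) ∨ x = (w ⟨n - a, ha2⟩ : ℕ)

/-- A partial flag `0 = V_0 ⊂ V_1 ⊂ ⋯ ⊂ V_r = ℂ^n` with `r` steps (the dimensions are
prescribed separately, via `OfType`). -/
structure PartialFlag (n r : ℕ) where
  V : Fin (r + 1) → Submodule ℂ (Fin n → ℂ)
  mono : Monotone V

/-- A partial flag is of type `f` (with partial sums `δ`) if `dim V_i = δ_i` for all `i`. -/
def OfType (n r : ℕ) (δ : ℕ → ℕ) (F : PartialFlag n r) : Prop :=
  ∀ i : Fin (r + 1), Module.finrank ℂ (F.V i) = δ (i : ℕ)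

/-- `w` is a minimal coset representative for the dimension sequence with partial sums `δ`:
it is increasing on each block of positions `δ_{i-1}+1, …, δ_i`. -/
def MinimalRep (n r : ℕ) (δ : ℕ → ℕ) (w : Equiv.Perm (Fin n)) : Prop :=
  ∀ i a b : ℕ, 1 ≤ i → i ≤ r → δ (i - 1) < a → a < b → b ≤ δ i →
    ∀ (ha : a - 1 < n) (hb : b - 1 < n), (w ⟨a - 1, ha⟩ : Fin n) < w ⟨b - 1, hb⟩

/-- Membership of a partial flag in the Schubert variety `S_w` of the partial flag manifold:
`dim (V_i ∩ E_j) ≥ #{a : 1 ≤ a ≤ δ_i, w(a) ≤ j}` for all `i` and all `1 ≤ j ≤ n`. -/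
def InSchubertP (n r : ℕ) (δ : ℕ → ℕ) (w : Equiv.Perm (Fin n)) (F : PartialFlag n r) : Prop :=
  ∀ (i : Fin (r + 1)) (j : ℕ), 1 ≤ j → j ≤ n →
    (Finset.univ.filter (fun a : Fin n => (a : ℕ) < δ (i : ℕ) ∧ ((w a : ℕ)) < j)).card
      ≤ Module.finrank ℂ ↥(F.V i ⊓ stdE n j)

/-- A partial flag of type `f` (partial sums `δ`) is isotropic if
`dim (V_i ∩ (V_j)^⊥) = min (δ_i, n - δ_j)` for all `1 ≤ i, j ≤ r`. -/
def IsotropicP (n r : ℕ) (δ : ℕ → ℕ) (F : PartialFlag n r) : Prop :=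
  ∀ i j : Fin (r + 1), 1 ≤ (i : ℕ) → 1 ≤ (j : ℕ) →
    Module.finrank ℂ ↥(F.V i ⊓ bOrtho n (F.V j)) = min (δ (i : ℕ)) (n - δ (j : ℕ))

/-- A partial flag of type `f` (partial sums `δ`) is `τ`-generic if
`dim (V_i ∩ τ(V_j)) = max (0, δ_i + δ_j - n)` for all `1 ≤ i, j ≤ r`
(truncated subtraction on `ℕ` realizes the `max` with `0`). -/
def TauGenericP (n r : ℕ) (δ : ℕ → ℕ) (F : PartialFlag n r) : Prop :=
  ∀ i j : Fin (r + 1), 1 ≤ (i : ℕ) → 1 ≤ (j : ℕ) →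
    Module.finrank ℂ ↥(F.V i ⊓ conjSubmodule n (F.V j)) = δ (i : ℕ) + δ (j : ℕ) - n

/-- The generalized spacing condition for a symmetric dimension sequence `f` with `r` blocks
and partial sums `δ`: for each `1 ≤ j ≤ ⌊r/2⌋` there is a bijection `φ` of `{1,…,f_j}`
with `w(δ_{r-j} + φ(i)) < w(δ_{j-1} + i)` for all `i`. -/
def GenSpacing (n r : ℕ) (f δ : ℕ → ℕ) (w : Equiv.Perm (Fin n)) : Prop :=
  ∀ j : ℕ, 1 ≤ j → j ≤ r / 2 →
    ∃ φ : Equiv.Perm (Fin (f j)), ∀ i : Fin (f j),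
      ∀ (h1 : δ (r - j) + (φ i : ℕ) < n) (h2 : δ (j - 1) + (i : ℕ) < n),
        (w ⟨δ (r - j) + (φ i : ℕ), h1⟩ : Fin n) < w ⟨δ (j - 1) + (i : ℕ), h2⟩

/-- The generalized double box contraction condition for a symmetric dimension sequence
built from `d = (d_1,…,d_s)` (with `r` blocks in total and partial sums `δ`): there are
pairwise distinct numbers `k_i^j, l_i^j ∈ {1,…,n}` such that block `j` of `w` consists of the
`k_i^j`, block `r+1-j` consists of the `l_i^j`, `l_i^j < k_i^j`, and every number strictly
between `l_i^j` and `k_i^j` belongs to an earlier block pair. (Values are `1`-based here.) -/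
def GenDoubleBox (n s r : ℕ) (d δ : ℕ → ℕ) (w : Equiv.Perm (Fin n)) : Prop :=
  ∃ k l : ℕ → ℕ → ℕ,
    (∀ j i, 1 ≤ j → j ≤ s → 1 ≤ i → i ≤ d j →
      1 ≤ k j i ∧ k j i ≤ n ∧ 1 ≤ l j i ∧ l j i ≤ n) ∧
    (∀ j i j' i', 1 ≤ j → j ≤ s → 1 ≤ i → i ≤ d j → 1 ≤ j' → j' ≤ s → 1 ≤ i' → i' ≤ d j' →
      (k j i = k j' i' → j = j' ∧ i = i') ∧
      (l j i = l j' i' → j = j' ∧ i = i') ∧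
      k j i ≠ l j' i') ∧
    (∀ j a, 1 ≤ j → j ≤ s → δ (j - 1) < a → a ≤ δ j →
      ∀ ha : a - 1 < n, ∃ i, 1 ≤ i ∧ i ≤ d j ∧ (w ⟨a - 1, ha⟩ : ℕ) + 1 = k j i) ∧
    (∀ j a, 1 ≤ j → j ≤ s → δ (r - j) < a → a ≤ δ (r + 1 - j) →
      ∀ ha : a - 1 < n, ∃ i, 1 ≤ i ∧ i ≤ d j ∧ (w ⟨a - 1, ha⟩ : ℕ) + 1 = l j i) ∧
    (∀ j i, 1 ≤ j → j ≤ s → 1 ≤ i → i ≤ d j →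
      l j i < k j i ∧
      ∀ x : ℕ, l j i < x → x < k j i →
        ∃ j' i', 1 ≤ j' ∧ j' < j ∧ 1 ≤ i' ∧ i' ≤ d j' ∧ (x = k j' i' ∨ x = l j' i'))

/-- The ordered basis `(u_1,…,u_n)` of intersection points: for `1 ≤ j ≤ ⌊n/2⌋`,
`u_j = ε_j • 𝐢 • e_{w(n+1-j)} + e_{w(j)}`, and `u_j = e_{w(j)}` for `⌊n/2⌋ < j ≤ n`
(this covers both the middle vector `e_{l_*}` and the vectors `u_{n+1-j} = e_{l_j}`). -/
def uVec (n : ℕ) (w : Equiv.Perm (Fin n)) (ε : ℕ → ℂ) (j : ℕ) : Fin n → ℂ :=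
  if h : 1 ≤ j ∧ j ≤ n then
    if j ≤ n / 2 then
      (ε j * Complex.I) • (Pi.single (w ⟨n - j, by omega⟩) (1 : ℂ) : Fin n → ℂ)
        + Pi.single (w ⟨j - 1, by omega⟩) (1 : ℂ)
    else Pi.single (w ⟨j - 1, by omega⟩) (1 : ℂ)
  else 0


lemma sum_range_nested_widths {n k : ℕ} (hk : 2 * k ≤ n) :
    ∑ i ∈ Finset.range k, (n - i - (i + 1)) = k * (n - k) := by
  induction k with
  | zero => simp
  | succ k ih =>
    rw [Finset.sum_range_succ, ih (by omega)]
    obtain ⟨c, rfl⟩ : ∃ c, n = 2 * k + 2 + c := ⟨n - (2 * k + 2), by omega⟩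
    rw [show 2 * k + 2 + c - k = k + 2 + c by omega,
      show k + 2 + c - (k + 1) = c + 1 by omega,
      show 2 * k + 2 + c - (k + 1) = k + 1 + c by omega]
    ring

/-- Under the spacing condition, a position `x` whose value lies strictly between `w(n)` and
`w(1)` forces more than `⌊n/2⌋ * (n - ⌊n/2⌋)` inversions. -/
lemma Spacing.lt_invCount_of_between {n : ℕ} {w : Equiv.Perm (Fin n)} (hsp : Spacing n w)
    (hn : 0 < n) {x : Fin n} (hlast : w ⟨n - 1, by omega⟩ < w x) (hfirst : w x < w ⟨0, hn⟩) :
    n / 2 * (n - n / 2) < invCount n w := by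
  classical
  set I := Finset.univ.filter (fun p : Fin n × Fin n => p.1 < p.2 ∧ w p.2 < w p.1) with hI
  set last : Fin n := ⟨n - 1, by omega⟩ with hlast_def
  have hx0 : (x : ℕ) ≠ 0 := by
    intro h
    rw [show x = ⟨0, hn⟩ from Fin.ext h] at hfirst
    exact lt_irrefl _ hfirst
  have hxlast : x < last := by
    refine lt_of_le_of_ne (Fin.le_def.2 (by simp only [hlast_def]; omega)) ?_
    intro h
    rw [h] at hlast
    exact lt_irrefl _ hlast
  have hmem : (x, last) ∈ I := by simp [hI, hxlast, hlast]
  let T : Finset (Σ _ : ℕ, ℕ) := (Finset.range (n / 2)).sigma fun i => Finset.Ico (i + 1) (n - i)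
  let g : Fin n × Fin n → Σ _ : ℕ, ℕ := fun p =>
    if (p.1 : ℕ) + p.2 < n then ⟨p.1, p.2⟩ else ⟨n - 1 - p.2, p.1⟩
  have hT : T.card = n / 2 * (n - n / 2) := by
    simp only [T, Finset.card_sigma, Nat.card_Ico]
    exact sum_range_nested_widths (by omega)
  have hsub : T ⊆ (I.erase (x, last)).image g := by
    rintro ⟨i, j⟩ hij
    simp only [T, Finset.mem_sigma, Finset.mem_range, Finset.mem_Ico] at hij
    obtain ⟨him, hij, hjn⟩ := hij
    have hpair : w ⟨n - (i + 1), by omega⟩ < w ⟨i, by omega⟩ :=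
      hsp (i + 1) (by omega) (by omega) (by omega) (by omega)
    simp only [Finset.mem_image, Finset.mem_erase, hI, Finset.mem_filter, Finset.mem_univ,
      true_and]
    by_cases hinv : w ⟨j, by omega⟩ < w ⟨i, by omega⟩
    · refine ⟨(⟨i, by omega⟩, ⟨j, by omega⟩), ⟨?_, ?_, hinv⟩, ?_⟩
      · intro h
        simp only [Prod.mk.injEq, Fin.ext_iff, hlast_def] at h
        omega
      · exact Fin.mk_lt_mk.2 (by omega)
      · simp only [g]
        rw [if_pos (by omega)]
    · have hj : j ≠ n - (i + 1) := by
        rintro rfl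
        exact hinv hpair
      refine ⟨(⟨j, by omega⟩, ⟨n - (i + 1), by omega⟩), ⟨?_, ?_, ?_⟩, ?_⟩
      · intro h
        simp only [Prod.mk.injEq, hlast_def, Fin.mk.injEq] at h
        obtain ⟨hjx, h⟩ := h
        obtain rfl : i = 0 := by omega
        rw [hjx] at hinv
        exact hinv hfirst
      · exact Fin.mk_lt_mk.2 (by omega)
      · exact hpair.trans_le (not_lt.1 hinv)
      · simp only [g]
        rw [if_neg (by omega), show n - 1 - (n - (i + 1)) = i by omega]
  calc n / 2 * (n - n / 2) = T.card := hT.symm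
    _ ≤ (I.erase (x, last)).card := (Finset.card_le_card hsub).trans Finset.card_image_le
    _ < invCount n w := Finset.card_erase_lt_of_mem hmem

/-- If `n ≥ 2`, `m = ⌊n/2⌋`, `w` satisfies the spacing condition and
`ℓ(w) = m²` (if `n = 2m`) resp. `ℓ(w) = m² + m` (if `n = 2m+1`), then `w(n) = w(1) - 1`. -/
theorem spacing_min_length_last_eq_first_sub_one
    (n : ℕ) (hn : 2 ≤ n) (w : Equiv.Perm (Fin n)) (hsp : Spacing n w)
    (heven : n = 2 * (n / 2) → invCount n w = (n / 2) ^ 2)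
    (hodd : n = 2 * (n / 2) + 1 → invCount n w = (n / 2) ^ 2 + n / 2) :
    (w ⟨n - 1, by omega⟩ : ℕ) + 1 = (w ⟨0, by omega⟩ : ℕ) := by
  have hlt : w ⟨n - 1, by omega⟩ < w ⟨0, by omega⟩ :=
    hsp 1 le_rfl (by omega) (by omega) (by omega)
  have hcount : invCount n w = n / 2 * (n - n / 2) := by
    rcases Nat.even_or_odd' n with ⟨m, h | h⟩
    · rw [heven (by omega), sq]
      congr 1
      omega
    · rw [hodd (by omega), sq, show n - n / 2 = n / 2 + 1 by omega]
      ring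
  by_contra hne
  have hval : (w ⟨n - 1, by omega⟩ : ℕ) < w ⟨0, by omega⟩ := hlt
  obtain ⟨x, hx⟩ := w.surjective
    ⟨(w ⟨n - 1, by omega⟩ : ℕ) + 1, by have := (w ⟨0, by omega⟩).isLt; omega⟩
  refine (hsp.lt_invCount_of_between (by omega) (x := x) ?_ ?_).ne' hcount
  · rw [hx, Fin.lt_def]
    exact Nat.lt_succ_self _
  · rw [hx, Fin.lt_def]
    exact lt_of_le_of_ne hval hne
end
end

section
/- Let n be a positive integer, m = ⌊n/2⌋, and let w be a permutation of {1,…,n} satisfying the double box contraction condition. Then w satisfies the spacing condition (w(n+1−i) < w(i) for all 1 ≤ i ≤ m), and ℓ(w) = m² if n = 2m, while ℓ(w) = m² + m if n = 2m+1. -/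
noncomputable section

/-- In a double box permutation, the value at a position strictly between `a` and its mirror
image lies outside the interval spanned by the values at `a` and its mirror image. -/
theorem DoubleBox.lt_or_lt {n : ℕ} {w : Equiv.Perm (Fin n)} (hdb : DoubleBox n w)
    {a p : Fin n} (hap : a < p) (hpa : p < a.rev) : w p < w a.rev ∨ w a < w p := by
  have hpa' : (p : ℕ) < n - (a + 1) := by simpa [Fin.lt_def, Fin.val_rev] using hpa
  have hap' : (a : ℕ) < p := hap
  have hp := p.isLt
  obtain ⟨-, h⟩ := hdb (a + 1) (by omega) (by omega) (by omega) (by omega)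
  by_contra! hc
  have h1 : w a.rev ≠ w p := fun e => hpa.ne' (w.injective e)
  have h2 : w p ≠ w a := fun e => hap.ne' (w.injective e)
  obtain ⟨b, hb1, hb2, hb⟩ := h (w p) (Fin.lt_def.mp (lt_of_le_of_ne hc.1 h1))
    (Fin.lt_def.mp (lt_of_le_of_ne hc.2 h2))
  rcases hb (by omega) (by omega) with e | e
  · have := congrArg Fin.val (w.injective (Fin.ext e))
    simp only at this
    omega
  · have := congrArg Fin.val (w.injective (Fin.ext e))
    simp only at this
    omega

theorem DoubleBox.rev_lt {n : ℕ} {w : Equiv.Perm (Fin n)} (hdb : DoubleBox n w)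
    {a : Fin n} (ha : a < a.rev) : w a.rev < w a := by
  have ha' : (a : ℕ) < n - (a + 1) := by simpa [Fin.lt_def, Fin.val_rev] using ha
  exact (hdb (a + 1) (by omega) (by omega) (by omega) (by omega)).1

theorem DoubleBox.spacing {n : ℕ} {w : Equiv.Perm (Fin n)} (hdb : DoubleBox n w) :
    Spacing n w :=
  fun i hi hin h1 h2 => (hdb i hi hin h1 h2).1

theorem card_filter_lt_and_le_rev (n : ℕ) :
    (Finset.univ.filter (fun p : Fin n × Fin n => p.1 < p.2 ∧ p.2 ≤ p.1.rev)).card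
      = n / 2 * (n - n / 2) := by
  have hcard : (Finset.univ.filter (fun p : Fin n × Fin n => p.1 < p.2 ∧ p.2 ≤ p.1.rev)).card
      = ((Finset.range (n / 2)).sigma fun a => Finset.Ioc a (n - 1 - a)).card := by
    refine Finset.card_bij (fun p _ => ⟨p.1, p.2⟩) ?_ ?_ ?_
    · rintro ⟨a, b⟩ h
      simp only [Finset.mem_filter, Finset.mem_univ, true_and, Finset.mem_sigma,
        Finset.mem_range, Finset.mem_Ioc, Fin.lt_def, Fin.le_def, Fin.val_rev] at h ⊢
      omega
    · rintro ⟨a, b⟩ - ⟨c, d⟩ - h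
      simp only [Sigma.mk.injEq, heq_eq_eq] at h
      exact Prod.ext (Fin.ext h.1) (Fin.ext h.2)
    · rintro ⟨a, b⟩ h
      simp only [Finset.mem_sigma, Finset.mem_range, Finset.mem_Ioc] at h
      refine ⟨(⟨a, by omega⟩, ⟨b, by omega⟩), ?_, rfl⟩
      simp only [Finset.mem_filter, Finset.mem_univ, true_and, Fin.lt_def, Fin.le_def, Fin.val_rev]
      omega
  have hsum : ∀ k ≤ n / 2, ∑ a ∈ Finset.range k, (n - 1 - a - a) = k * (n - k) := by
    intro k hk
    induction k with
    | zero => simp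
    | succ k ih =>
      rw [Finset.sum_range_succ, ih (by omega)]
      obtain ⟨c, rfl⟩ : ∃ c, n = 2 * k + 2 + c := ⟨n - (2 * k + 2), by omega⟩
      rw [show 2 * k + 2 + c - k = k + 2 + c by omega,
        show 2 * k + 2 + c - 1 - k - k = 1 + c by omega,
        show 2 * k + 2 + c - (k + 1) = k + 1 + c by omega]
      ring
  rw [hcard, Finset.card_sigma]
  simpa using hsum _ le_rfl

theorem DoubleBox.invCount_eq {n : ℕ} {w : Equiv.Perm (Fin n)} (hdb : DoubleBox n w) :
    invCount n w = n / 2 * (n - n / 2) := by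
  rw [← card_filter_lt_and_le_rev, invCount]
  refine Finset.card_bij (fun p _ => if p.2 ≤ p.1.rev then p else (p.2.rev, p.1)) ?_ ?_ ?_
  · rintro ⟨a, b⟩ h
    simp only [Finset.mem_filter, Finset.mem_univ, true_and] at h ⊢
    split_ifs with hb
    · exact ⟨h.1, hb⟩
    · simp only [Fin.lt_def, Fin.le_def, Fin.val_rev, Fin.rev_rev] at *
      omega
  · have key : ∀ i p : Fin n, p ≤ i.rev → ¬ i.rev ≤ p.rev → i.rev ≠ p → w p < w i →
        w i.rev < w p → False := by
      intro i p h1 h2 h3 h4 h5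
      have hpi : i < p := by
        simp only [Fin.lt_def, Fin.le_def, Fin.val_rev] at *
        omega
      rcases hdb.lt_or_lt hpi (lt_of_le_of_ne h1 h3.symm) with h | h
      · exact lt_asymm h h5
      · exact lt_asymm h h4
    rintro ⟨a, b⟩ h ⟨c, d⟩ h' e
    simp only [Finset.mem_filter, Finset.mem_univ, true_and] at h h'
    dsimp only at e
    split_ifs at e with h1 h2 h2
    · exact e
    · obtain ⟨rfl, rfl⟩ := Prod.mk.inj e
      refine (key d.rev b h1 (by simpa using h2) (by simpa using h'.1.ne') h.2
        (by simpa using h'.2)).elim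
    · obtain ⟨rfl, rfl⟩ := Prod.mk.inj e
      refine (key b.rev a h2 (by simpa using h1) (by simpa using h.1.ne') h'.2
        (by simpa using h.2)).elim
    · obtain ⟨h3, rfl⟩ := Prod.mk.inj e
      rw [Fin.rev_inj.mp h3]
  · rintro ⟨i, p⟩ h
    simp only [Finset.mem_filter, Finset.mem_univ, true_and] at h
    obtain ⟨hip, hpi⟩ := h
    rcases hpi.eq_or_lt with rfl | hlt
    · exact ⟨(i, i.rev), by simpa using ⟨hip, hdb.rev_lt hip⟩, by simp⟩
    · rcases hdb.lt_or_lt hip hlt with h | h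
      · have := hdb.rev_lt (hip.trans hlt)
        exact ⟨(i, p), by simpa using ⟨hip, h.trans this⟩, by simp [hpi]⟩
      · exact ⟨(p, i.rev), by simpa using ⟨hlt, (hdb.rev_lt (hip.trans hlt)).trans h⟩,
          by simp [hip]⟩

/-- If `w` satisfies the double box contraction condition then it satisfies
the spacing condition, and `ℓ(w) = m²` if `n = 2m`, `ℓ(w) = m² + m` if `n = 2m+1`,
where `m = ⌊n/2⌋`. -/
theorem doubleBox_imp_spacing_and_length
    (n : ℕ) (hn : 0 < n) (w : Equiv.Perm (Fin n)) (hdb : DoubleBox n w) :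
    Spacing n w ∧
      (n = 2 * (n / 2) → invCount n w = (n / 2) ^ 2) ∧
      (n = 2 * (n / 2) + 1 → invCount n w = (n / 2) ^ 2 + n / 2) := by
  refine ⟨hdb.spacing, fun h => ?_, fun h => ?_⟩
  · rw [hdb.invCount_eq, show n - n / 2 = n / 2 by omega, sq]
  · rw [hdb.invCount_eq, show n - n / 2 = n / 2 + 1 by omega]
    ring
end
end

section
/- Let n be a positive integer, m = ⌊n/2⌋, and let w be a permutation of {1,…,n}. Then w satisfies the double box contraction condition if and only if w satisfies the spacing condition and ℓ(w) = m² in case n = 2m, respectively ℓ(w) = m² + m in case n = 2m+1. -/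
noncomputable section

/-- The positions strictly between `i` and its mirror image `i.rev` whose value under `w` lies
strictly between `w i.rev` and `w i`. -/
def innerBetween (n : ℕ) (w : Equiv.Perm (Fin n)) (i : Fin n) : Finset (Fin n) :=
  (Finset.Ioo i i.rev).filter (fun x => w i.rev < w x ∧ w x < w i)

/-- The inversions of `w` whose outermost position, up to mirror symmetry, is `i`. -/
def layerInversions (n : ℕ) (w : Equiv.Perm (Fin n)) (i : Fin n) : Finset (Fin n × Fin n) :=
  (Finset.univ.filter (fun p : Fin n × Fin n => p.1 < p.2 ∧ w p.2 < w p.1)).filter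
    (fun p => min p.1 p.2.rev = i)

theorem layerInversions_eq (n : ℕ) (w : Equiv.Perm (Fin n)) (i : Fin n) (hi : i < i.rev)
    (hw : w i.rev < w i) :
    layerInversions n w i =
      insert (i, i.rev)
        (((Finset.Ioo i i.rev).filter (fun x => w x < w i)).image (fun x => (i, x)) ∪
          ((Finset.Ioo i i.rev).filter (fun x => w i.rev < w x)).image (fun x => (x, i.rev))) := by
  ext ⟨a, b⟩
  simp only [layerInversions, Finset.mem_filter, Finset.mem_univ, true_and, Finset.mem_insert,
    Finset.mem_union, Finset.mem_image, Finset.mem_Ioo, Prod.mk.injEq]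
  constructor
  · rintro ⟨⟨hab, hinv⟩, hmin⟩
    rcases lt_trichotomy a b.rev with h | h | h
    · rw [min_eq_left h.le] at hmin
      subst hmin
      exact Or.inr (Or.inl ⟨b, ⟨⟨hab, Fin.lt_rev_iff.mp h⟩, hinv⟩, rfl, rfl⟩)
    · subst h
      rw [min_self] at hmin
      subst hmin
      exact Or.inl ⟨rfl, (Fin.rev_rev b).symm⟩
    · rw [min_eq_right h.le] at hmin
      subst hmin
      rw [Fin.rev_rev] at *
      exact Or.inr (Or.inr ⟨a, ⟨⟨h, hab⟩, hinv⟩, rfl, rfl⟩)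
  · rintro (⟨rfl, rfl⟩ | ⟨x, ⟨⟨h₁, h₂⟩, h₃⟩, rfl, rfl⟩ | ⟨x, ⟨⟨h₁, h₂⟩, h₃⟩, rfl, rfl⟩)
    · exact ⟨⟨hi, hw⟩, by rw [Fin.rev_rev, min_self]⟩
    · exact ⟨⟨h₁, h₃⟩, min_eq_left (Fin.lt_rev_iff.mpr h₂).le⟩
    · exact ⟨⟨h₂, h₃⟩, by rw [Fin.rev_rev, min_eq_right h₁.le]⟩

theorem card_layerInversions (n : ℕ) (w : Equiv.Perm (Fin n)) (i : Fin n) (hi : i < i.rev)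
    (hw : w i.rev < w i) :
    (layerInversions n w i).card = (n - 1 - 2 * (i : ℕ)) + (innerBetween n w i).card := by
  have hunion : (Finset.Ioo i i.rev).filter (fun x => w x < w i) ∪
      (Finset.Ioo i i.rev).filter (fun x => w i.rev < w x) = Finset.Ioo i i.rev := by
    rw [← Finset.filter_or, Finset.filter_true_of_mem]
    intro x _
    rcases lt_or_ge (w x) (w i) with h | h
    · exact Or.inl h
    · exact Or.inr (hw.trans_le h)
  have hinter : (Finset.Ioo i i.rev).filter (fun x => w x < w i) ∩
      (Finset.Ioo i i.rev).filter (fun x => w i.rev < w x) = innerBetween n w i := by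
    rw [← Finset.filter_and]
    exact Finset.filter_congr fun x _ => and_comm
  have hcard := Finset.card_union_add_card_inter
    ((Finset.Ioo i i.rev).filter (fun x => w x < w i))
    ((Finset.Ioo i i.rev).filter (fun x => w i.rev < w x))
  rw [hunion, hinter, Fin.card_Ioo, Fin.val_rev] at hcard
  rw [layerInversions_eq n w i hi hw, Finset.card_insert_of_notMem, Finset.card_union_of_disjoint,
    Finset.card_image_of_injective _ (Prod.mk_right_injective i),
    Finset.card_image_of_injective _ (Prod.mk_left_injective i.rev)]
  · have h : (i : ℕ) < n - (i + 1) := by simpa [Fin.lt_def, Fin.val_rev] using hi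
    omega
  · rw [Finset.disjoint_left]
    simp only [Finset.mem_image, Finset.mem_filter, Finset.mem_Ioo]
    rintro _ ⟨x, ⟨⟨_, h⟩, _⟩, rfl⟩ ⟨y, ⟨⟨h', _⟩, _⟩, hy⟩
    exact h'.ne' (congrArg Prod.fst hy)
  · simp only [Finset.mem_union, Finset.mem_image, Finset.mem_filter, Finset.mem_Ioo,
      Prod.mk.injEq]
    rintro (⟨x, ⟨⟨_, h⟩, _⟩, _, hx⟩ | ⟨x, ⟨⟨h, _⟩, _⟩, hx, _⟩)
    · exact h.ne hx
    · exact h.ne' hx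

theorem sum_range_sub_two_mul (n m : ℕ) (h : 2 * m ≤ n) :
    ∑ i ∈ Finset.range m, (n - 1 - 2 * i) = m * (n - m) := by
  induction m with
  | zero => simp
  | succ m ih =>
    rw [Finset.sum_range_succ, ih (by omega)]
    obtain ⟨k, rfl⟩ := Nat.exists_eq_add_of_le h
    rw [show 2 * (m + 1) + k - m = m + 2 + k by omega,
      show 2 * (m + 1) + k - 1 - 2 * m = k + 1 by omega,
      show 2 * (m + 1) + k - (m + 1) = m + 1 + k by omega]
    ring

theorem sum_lt_rev_sub_two_mul (n : ℕ) :
    ∑ i ∈ Finset.univ.filter (fun i : Fin n => i < i.rev), (n - 1 - 2 * (i : ℕ)) =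
      n / 2 * (n - n / 2) := by
  rw [← sum_range_sub_two_mul n (n / 2) (by omega)]
  refine Finset.sum_bij (fun i _ => (i : ℕ)) ?_ (fun _ _ _ _ h => Fin.ext h) ?_ fun _ _ => rfl
  · intro i hi
    simp only [Finset.mem_filter, Finset.mem_univ, true_and, Fin.lt_def, Fin.val_rev,
      Finset.mem_range] at hi ⊢
    omega
  · intro i hi
    rw [Finset.mem_range] at hi
    refine ⟨⟨i, by omega⟩, ?_, rfl⟩
    simp only [Finset.mem_filter, Finset.mem_univ, true_and, Fin.lt_def, Fin.val_rev]
    omega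

theorem spacing_iff_rev (n : ℕ) (w : Equiv.Perm (Fin n)) :
    Spacing n w ↔ ∀ i : Fin n, i < i.rev → w i.rev < w i := by
  constructor
  · intro h i hi
    rw [Fin.lt_def, Fin.val_rev] at hi
    exact h (i + 1) (by omega) (by omega) (by omega) (by omega)
  · intro h i h1 h2 h3 h4
    have hrev : (⟨i - 1, h4⟩ : Fin n).rev = ⟨n - i, h3⟩ := by
      ext
      simp only [Fin.val_rev]
      omega
    have := h ⟨i - 1, h4⟩ (by rw [hrev, Fin.lt_def]; simp only; omega)
    rwa [hrev] at this

theorem Spacing.invCount_eq {n : ℕ} {w : Equiv.Perm (Fin n)} (h : Spacing n w) :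
    invCount n w = n / 2 * (n - n / 2) +
      ∑ i ∈ Finset.univ.filter (fun i : Fin n => i < i.rev), (innerBetween n w i).card := by
  rw [spacing_iff_rev] at h
  rw [← sum_lt_rev_sub_two_mul, ← Finset.sum_add_distrib, invCount,
    Finset.card_eq_sum_card_fiberwise (f := fun p : Fin n × Fin n => min p.1 p.2.rev)
      (t := Finset.univ.filter (fun i : Fin n => i < i.rev))]
  · refine Finset.sum_congr rfl fun i hi => ?_
    have hi' : i < i.rev := (Finset.mem_filter.mp hi).2
    exact card_layerInversions n w i hi' (h i hi')
  · rintro ⟨a, b⟩ hp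
    simp only [Finset.coe_filter, Finset.mem_univ, true_and, Set.mem_ofPred_eq] at hp ⊢
    have hab := hp.1
    rcases le_total a b.rev with hle | hle
    · rw [min_eq_left hle]
      exact hab.trans_le (Fin.le_rev_iff.mp hle)
    · rw [min_eq_right hle, Fin.rev_rev]
      exact hle.trans_lt hab

theorem doubleBox_iff_innerBetween_eq_empty (n : ℕ) (w : Equiv.Perm (Fin n)) :
    DoubleBox n w ↔ Spacing n w ∧ ∀ i : Fin n, i < i.rev → innerBetween n w i = ∅ := by
  constructor
  · intro h
    refine ⟨fun i h1 h2 h3 h4 => (h i h1 h2 h3 h4).1, fun i hi => ?_⟩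
    rw [innerBetween, Finset.filter_eq_empty_iff]
    rintro x hx ⟨hx₁, hx₂⟩
    rw [Finset.mem_Ioo, Fin.lt_def, Fin.lt_def, Fin.val_rev] at hx
    rw [Fin.lt_def, Fin.val_rev] at hi
    obtain ⟨a, ha1, ha2, ha⟩ :=
      (h (i + 1) (by omega) (by omega) (by omega) (by omega)).2 (w x) hx₁ hx₂
    rcases ha (by omega) (by omega) with ha | ha <;>
    · have := congrArg Fin.val (w.injective (Fin.ext ha))
      simp only at this
      omega
  · rintro ⟨hs, he⟩ i h1 h2 h3 h4
    refine ⟨hs i h1 h2 h3 h4, fun x hx₁ hx₂ => ?_⟩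
    have hrev : (⟨i - 1, h4⟩ : Fin n).rev = ⟨n - i, h3⟩ := by
      ext
      simp only [Fin.val_rev]
      omega
    have hi := he ⟨i - 1, h4⟩ (by rw [hrev, Fin.lt_def]; simp only; omega)
    rw [innerBetween, Finset.filter_eq_empty_iff, hrev] at hi
    obtain ⟨y, hy⟩ := w.surjective ⟨x, hx₂.trans (w _).isLt⟩
    have hyx : (w y : ℕ) = x := by rw [hy]
    subst hyx
    have hmem : ¬ (i - 1 < (y : ℕ) ∧ (y : ℕ) < n - i) := fun hc =>
      hi (Finset.mem_Ioo.mpr hc) ⟨hx₁, hx₂⟩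
    have hne₁ : (y : ℕ) ≠ i - 1 := by
      intro hc
      rw [show y = ⟨i - 1, h4⟩ from Fin.ext hc] at hx₂
      exact lt_irrefl _ hx₂
    have hne₂ : (y : ℕ) ≠ n - i := by
      intro hc
      rw [show y = ⟨n - i, h3⟩ from Fin.ext hc] at hx₁
      exact lt_irrefl _ hx₁
    have hyn := y.isLt
    rcases lt_or_ge (y : ℕ) (i - 1) with hlt | hge
    · exact ⟨y + 1, by omega, by omega, fun _ _ => Or.inl rfl⟩
    · refine ⟨n - y, by omega, by omega, fun _ _ => Or.inr ?_⟩
      congr 2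
      ext
      simp only
      omega

theorem Spacing.forall_innerBetween_eq_empty_iff {n : ℕ} {w : Equiv.Perm (Fin n)}
    (h : Spacing n w) :
    (∀ i : Fin n, i < i.rev → innerBetween n w i = ∅) ↔
      invCount n w = n / 2 * (n - n / 2) := by
  rw [h.invCount_eq, Nat.add_eq_left, Finset.sum_eq_zero_iff]
  simp

/-- `w` satisfies the double box contraction condition iff it satisfies the
spacing condition and `ℓ(w) = m²` in case `n = 2m`, resp. `ℓ(w) = m² + m` in case
`n = 2m+1`, where `m = ⌊n/2⌋`. -/
theorem doubleBox_iff_spacing_and_length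
    (n : ℕ) (hn : 0 < n) (w : Equiv.Perm (Fin n)) :
    DoubleBox n w ↔
      (Spacing n w ∧
        (n = 2 * (n / 2) → invCount n w = (n / 2) ^ 2) ∧
        (n = 2 * (n / 2) + 1 → invCount n w = (n / 2) ^ 2 + n / 2)) := by
  rw [doubleBox_iff_innerBetween_eq_empty]
  refine and_congr_right fun hs => ?_
  rw [hs.forall_innerBetween_eq_empty_iff]
  rcases Nat.even_or_odd' n with ⟨m, rfl | rfl⟩
  · rw [show 2 * m / 2 = m by omega, show 2 * m - m = m by omega, ← sq]
    simp
  · rw [show (2 * m + 1) / 2 = m by omega, show 2 * m + 1 - m = m + 1 by omega,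
      show m * (m + 1) = m ^ 2 + m by ring]
    simp
end
end

section
/- Let n be a positive integer, m = ⌊n/2⌋, and let w be a permutation of {1,…,n} satisfying the double box contraction condition. Write k_j = w(j) and l_j = w(n+1−j) for 1 ≤ j ≤ m, and l_* = w(m+1) if n = 2m+1. Then a complete flag V in ℂ^n is isotropic and lies in the Schubert variety S_w if and only if there exist signs ε_1,…,ε_m ∈ {+1,−1} such that V_p = span(u_1,…,u_p) for all p, where the ordered basis (u_1,…,u_n) of ℂ^n is given by u_j = ε_j·𝐢·e_{l_j} + e_{k_j} for 1 ≤ j ≤ m, u_{m+1} = e_{l_*} if n = 2m+1, and u_{n+1−j} = e_{l_j} for 1 ≤ j ≤ m (here 𝐢 is the imaginary unit). -/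
noncomputable section

section PairedBasis

variable {n : ℕ} (w : Equiv.Perm (Fin n)) (D : Fin n → ℂ)

/-- The vector `D a • e_{w(rev a)} + e_{w(a)}`. -/
def pairedVec (a : Fin n) : Fin n → ℂ :=
  D a • (Pi.single (w a.rev) (1 : ℂ) : Fin n → ℂ) + Pi.single (w a) (1 : ℂ)

/-- The coordinate functional dual to `pairedVec w D a` when `D a * D (rev a) = 0`. -/
def pairedCoord (a : Fin n) : (Fin n → ℂ) →ₗ[ℂ] ℂ :=
  LinearMap.proj (w a) - D a.rev • LinearMap.proj (w a.rev)

lemma pairedCoord_apply (a : Fin n) (x : Fin n → ℂ) :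
    pairedCoord w D a x = x (w a) - D a.rev * x (w a.rev) := by
  simp [pairedCoord]

lemma pairedVec_apply (a b : Fin n) :
    pairedVec w D a (w b) = (if b = a.rev then D a else 0) + (if b = a then 1 else 0) := by
  simp [pairedVec, Pi.single_apply]

variable {D}

lemma pairedCoord_pairedVec (hD : ∀ a, D a * D a.rev = 0) (a b : Fin n) :
    pairedCoord w D a (pairedVec w D b) = if a = b then 1 else 0 := by
  rw [pairedCoord_apply, pairedVec_apply, pairedVec_apply]
  have h1 : (a.rev = b.rev) ↔ a = b := Fin.rev_inj
  have h2 : (a.rev = b) ↔ a = b.rev := by rw [Fin.rev_eq_iff]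
  simp only [h1, h2]
  by_cases hab : a = b
  · subst hab
    have := hD a
    by_cases h3 : a = a.rev
    · rw [← h3] at this ⊢
      have h0 : D a = 0 := by simpa using this
      simp [h0]
    · simp only [h3, if_true, if_false]
      linear_combination -this
  · by_cases h3 : a = b.rev
    · subst h3
      simp [hab]
    · simp [hab, h3]

lemma sum_pairedCoord_smul (hD : ∀ a, D a * D a.rev = 0) (x : Fin n → ℂ) :
    ∑ a, pairedCoord w D a x • pairedVec w D a = x := by
  funext c
  obtain ⟨b, rfl⟩ := w.surjective c
  have h2 : ∀ a : Fin n, (b = a.rev) ↔ a = b.rev := fun a => by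
    rw [eq_comm, Fin.rev_eq_iff]
  simp only [Finset.sum_apply, Pi.smul_apply, smul_eq_mul, pairedVec_apply, mul_add,
    Finset.sum_add_distrib, h2, mul_ite, mul_zero, mul_one, Finset.sum_ite_eq',
    Finset.sum_ite_eq, Finset.mem_univ, if_true]
  rw [pairedCoord_apply, pairedCoord_apply, Fin.rev_rev]
  have := hD b
  linear_combination -x (w b) * this

lemma mem_span_pairedVec_iff (hD : ∀ a, D a * D a.rev = 0) (P : Fin n → Prop)
    (x : Fin n → ℂ) :
    x ∈ Submodule.span ℂ (pairedVec w D '' {a | P a}) ↔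
      ∀ a, ¬ P a → pairedCoord w D a x = 0 := by
  constructor
  · intro hx a ha
    have : Submodule.span ℂ (pairedVec w D '' {a | P a}) ≤ LinearMap.ker (pairedCoord w D a) := by
      rw [Submodule.span_le]
      rintro _ ⟨b, hb, rfl⟩
      have : a ≠ b := fun h => ha (h ▸ hb)
      simp [pairedCoord_pairedVec w hD, this]
    exact this hx
  · intro h
    rw [← sum_pairedCoord_smul w hD x]
    refine Submodule.sum_mem _ fun a _ => ?_
    by_cases ha : P a
    · exact Submodule.smul_mem _ _ (Submodule.subset_span ⟨a, ha, rfl⟩)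
    · simp [h a ha]

lemma linearIndependent_pairedVec (hD : ∀ a, D a * D a.rev = 0) :
    LinearIndependent ℂ (pairedVec w D) := by
  rw [Fintype.linearIndependent_iff]
  intro g hg a
  have := congrArg (pairedCoord w D a) hg
  simpa [pairedCoord_pairedVec w hD] using this

lemma finrank_span_pairedVec (hD : ∀ a, D a * D a.rev = 0) (P : Fin n → Prop)
    [DecidablePred P] :
    Module.finrank ℂ (Submodule.span ℂ (pairedVec w D '' {a | P a})) =
      (Finset.univ.filter P).card := by
  have h := (linearIndependent_pairedVec w hD).comp (Subtype.val : {a // P a} → Fin n)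
    Subtype.val_injective
  have h2 := finrank_span_eq_card h
  rw [Set.range_comp, Subtype.range_coe_subtype] at h2
  rw [h2, Fintype.card_subtype]

lemma card_filter_val_lt {p : ℕ} (hp : p ≤ n) :
    (Finset.univ.filter (fun a : Fin n => (a : ℕ) < p)).card = p := by
  simp [Fin.card_filter_val_lt, hp]

lemma sum_mul_pairedVec (x : Fin n → ℂ) (a : Fin n) :
    ∑ i, x i * pairedVec w D a i = D a * x (w a.rev) + x (w a) := by
  simp [pairedVec, mul_add, Finset.sum_add_distrib, Pi.single_apply, mul_comm]

lemma mem_bOrtho_span_iff (S : Set (Fin n → ℂ)) (x : Fin n → ℂ) :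
    x ∈ bOrtho n (Submodule.span ℂ S) ↔ ∀ v ∈ S, ∑ i, x i * v i = 0 := by
  constructor
  · intro h v hv
    exact h v (Submodule.subset_span hv)
  · intro h v hv
    induction hv using Submodule.span_induction with
    | mem v hv => exact h v hv
    | zero => simp
    | add u v _ _ hu hv => simp [mul_add, Finset.sum_add_distrib, hu, hv]
    | smul c v _ hv =>
      simp only [Pi.smul_apply, smul_eq_mul, mul_left_comm _ c]
      rw [← Finset.mul_sum, hv, mul_zero]

/-- The orthogonal complement of the span of the first `p` paired vectors is the span of the
first `n - p`. -/
lemma bOrtho_span_pairedVec (hD : ∀ a, D a * D a.rev = 0) {p : ℕ} (hp : p ≤ n)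
    (hD1 : ∀ a : Fin n, (a : ℕ) < p → D a * D a = -1) :
    bOrtho n (Submodule.span ℂ (pairedVec w D '' {a | (a : ℕ) < p})) =
      Submodule.span ℂ (pairedVec w D '' {a | (a : ℕ) < n - p}) := by
  ext x
  rw [mem_bOrtho_span_iff, mem_span_pairedVec_iff w hD]
  have key : ∀ a : Fin n, (a : ℕ) < p →
      (∑ i, x i * pairedVec w D a i = 0 ↔ pairedCoord w D a.rev x = 0) := by
    intro a ha
    rw [sum_mul_pairedVec, pairedCoord_apply, Fin.rev_rev]
    have := hD1 a ha
    constructor <;> intro h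
    · linear_combination (-D a) * h + x (w a.rev) * this
    · linear_combination D a * h + x (w a) * this
  constructor
  · intro h a ha
    have h1 : (a.rev : ℕ) < p := by rw [Fin.val_rev]; omega
    have := (key a.rev h1).1 (h _ ⟨a.rev, h1, rfl⟩)
    rwa [Fin.rev_rev] at this
  · rintro h _ ⟨a, ha, rfl⟩
    refine (key a ha).2 (h _ ?_)
    have := a.isLt
    change (a : ℕ) < p at ha
    rw [Fin.val_rev]; omega

end PairedBasis

lemma mem_stdE_iff {n j : ℕ} (x : Fin n → ℂ) :
    x ∈ stdE n j ↔ ∀ b : Fin n, j ≤ (b : ℕ) → x b = 0 := by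
  have h := mem_span_pairedVec_iff (D := 0) (1 : Equiv.Perm (Fin n)) (by simp)
    (fun a => (a : ℕ) < j) x
  have hv : pairedVec (1 : Equiv.Perm (Fin n)) 0 = fun i => (Pi.single i 1 : Fin n → ℂ) := by
    funext a; simp [pairedVec]
  rw [hv] at h
  simpa [pairedCoord_apply, stdE] using h

section Flag

variable {n : ℕ} {w : Equiv.Perm (Fin n)} {F : CompleteFlag n}

lemma mul_rev_eq_zero {D : Fin n → ℂ} {i : ℕ} (hi : i ≤ n / 2)
    (hD0 : ∀ a : Fin n, i ≤ (a : ℕ) → D a = 0) (a : Fin n) : D a * D a.rev = 0 := by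
  by_cases h : i ≤ (a : ℕ)
  · rw [hD0 a h, zero_mul]
  · rw [hD0 a.rev (by rw [Fin.val_rev]; omega), mul_zero]

lemma CompleteFlag.eq_span_pairedVec {D : Fin n → ℂ} (hD : ∀ a, D a * D a.rev = 0)
    {p : ℕ} (hp : p < n + 1)
    (hmem : ∀ (a : Fin n), (a : ℕ) < p → pairedVec w D a ∈ F.V a.succ) :
    F.V ⟨p, hp⟩ = Submodule.span ℂ (pairedVec w D '' {a | (a : ℕ) < p}) := by
  symm
  apply Submodule.eq_of_le_of_finrank_eq
  · rw [Submodule.span_le]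
    rintro _ ⟨a, ha, rfl⟩
    refine F.mono ?_ (hmem a ha)
    rw [Fin.le_def]
    exact ha
  · rw [finrank_span_pairedVec w hD, F.dim, card_filter_val_lt (by omega)]

/-- Vectors of the span of the first `p` paired vectors that lie in `E_j` are spanned by the
paired vectors whose leading index is below `j`. -/
lemma span_pairedVec_inf_stdE_le {D : Fin n → ℂ} (hD : ∀ a, D a * D a.rev = 0) {p j : ℕ}
    (hDp : ∀ a : Fin n, (a : ℕ) < p → D a.rev = 0) :
    Submodule.span ℂ (pairedVec w D '' {a | (a : ℕ) < p}) ⊓ stdE n j ≤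
      Submodule.span ℂ (pairedVec w D '' {a | (a : ℕ) < p ∧ (w a : ℕ) < j}) := by
  rintro x ⟨hx1, hx2⟩
  have hx2' := (mem_stdE_iff x).1 hx2
  have hx1' := (mem_span_pairedVec_iff w hD _ x).1 hx1
  rw [mem_span_pairedVec_iff w hD]
  intro a ha
  by_cases hap : (a : ℕ) < p
  · rw [pairedCoord_apply, hDp a hap, hx2' (w a) (by by_contra h; exact ha ⟨hap, by omega⟩)]
    simp
  · exact hx1' a hap

lemma CompleteFlag.top_eq {p : ℕ} (hp : p < n + 1) (h : p = n) : F.V ⟨p, hp⟩ = ⊤ := by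
  apply Submodule.eq_top_of_finrank_eq
  rw [F.dim]
  simp [h]

lemma IsotropicFlag.eq_span_pairedVec (hiso : IsotropicFlag n F) {D : Fin n → ℂ}
    (hD : ∀ a, D a * D a.rev = 0) {p : ℕ} (hp : p ≤ n / 2)
    (hD1 : ∀ a : Fin n, (a : ℕ) < p → D a * D a = -1)
    (hmem : ∀ (a : Fin n), (a : ℕ) < p → pairedVec w D a ∈ F.V a.succ) (h1 : n - p < n + 1) :
    F.V ⟨n - p, h1⟩ = Submodule.span ℂ (pairedVec w D '' {a | (a : ℕ) < n - p}) := by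
  rcases Nat.eq_zero_or_pos p with rfl | hp0
  · rw [CompleteFlag.top_eq h1 (by omega)]
    symm
    rw [eq_top_iff]
    intro x _
    rw [mem_span_pairedVec_iff w hD]
    exact fun a ha => absurd a.isLt ha
  · rw [hiso p hp0 hp h1 (by omega), CompleteFlag.eq_span_pairedVec hD (by omega) hmem,
      bOrtho_span_pairedVec w hD (by omega) hD1]

/-- The Schubert condition produces a vector of `V_{i+1} ∩ E_{w(i)}` outside `V_i`. -/
lemma InSchubert.exists_mem_notMem (hS : InSchubert n w F) {D : Fin n → ℂ} (i : Fin n)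
    (hD : ∀ a, D a * D a.rev = 0) (hDp : ∀ a : Fin n, a < i → D a.rev = 0)
    (hmem : ∀ a : Fin n, a < i → pairedVec w D a ∈ F.V a.succ) :
    ∃ v ∈ F.V i.succ, (∀ b, w i < b → v b = 0) ∧ v ∉ F.V i.castSucc := by
  by_contra! hcon
  have hV : F.V i.castSucc = _ :=
    CompleteFlag.eq_span_pairedVec hD i.castSucc.isLt (fun a ha => hmem a ha)
  have hle : F.V i.succ ⊓ stdE n (w i + 1) ≤
      Submodule.span ℂ (pairedVec w D '' {a | (a : ℕ) < i ∧ (w a : ℕ) < w i + 1}) := by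
    refine le_trans (le_inf ?_ inf_le_right) (span_pairedVec_inf_stdE_le (p := i) hD hDp)
    rintro v ⟨hv1, hv2⟩
    have := hcon v hv1 (fun b hb => (mem_stdE_iff v).1 hv2 b hb)
    rwa [hV] at this
  have h1 := Submodule.finrank_mono hle
  rw [finrank_span_pairedVec w hD] at h1
  have h2 := hS (i + 1) (w i + 1) (by omega) (by omega) (by omega) (by omega) (by omega)
  refine absurd (h2.trans h1) (not_le.2 (Finset.card_lt_card ?_))
  rw [Finset.ssubset_iff_of_subset]
  · exact ⟨i, by simp, by simp⟩
  · intro a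
    simp only [Finset.mem_filter, Finset.mem_univ, true_and]
    omega

/-- Below the value `w(rev i)`, the flag spaces `V_{n-i}` and `V_{n-i-1}` agree. -/
lemma InSchubert.inf_stdE_le (hS : InSchubert n w F) {D : Fin n → ℂ} (i : Fin n)
    (hi : (i : ℕ) < n / 2)
    (hD : ∀ a, D a * D a.rev = 0) (hD0 : ∀ a : Fin n, i ≤ a → D a = 0)
    (hV : F.V i.rev.succ = Submodule.span ℂ (pairedVec w D '' {a | (a : ℕ) < n - i})) :
    F.V i.rev.succ ⊓ stdE n (w i.rev) ≤ F.V i.rev.castSucc := by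
  have hr : (i.rev : ℕ) = n - (i + 1) := Fin.val_rev i
  rcases Nat.eq_zero_or_pos (w i.rev : ℕ) with h0 | h0
  · rintro v ⟨-, hv⟩
    have : v = 0 := funext fun b => (mem_stdE_iff v).1 hv b (by omega)
    rw [this]
    exact Submodule.zero_mem _
  have hle : F.V i.rev.succ ⊓ stdE n (w i.rev) ≤
      Submodule.span ℂ (pairedVec w D '' {a | (a : ℕ) < i.rev ∧ (w a : ℕ) < w i.rev}) := by
    rw [hV]
    refine (span_pairedVec_inf_stdE_le hD ?_).trans (Submodule.span_mono (Set.image_mono ?_))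
    · intro a ha
      refine hD0 _ ?_
      rw [Fin.le_def, Fin.val_rev]
      omega
    · rintro a ⟨ha1, ha2⟩
      refine ⟨?_, ha2⟩
      have : a ≠ i.rev := by rintro rfl; exact lt_irrefl _ ha2
      rw [Ne, Fin.ext_iff] at this
      omega
  have h1 := Submodule.finrank_mono hle
  rw [finrank_span_pairedVec w hD] at h1
  have h2 := hS i.rev (w i.rev) (by omega) (by omega) (by omega) (by omega) (by omega)
  have h3 : F.V i.rev.castSucc ⊓ stdE n (w i.rev) ≤ F.V i.rev.succ ⊓ stdE n (w i.rev) :=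
    inf_le_inf_right _ (F.mono (Fin.castSucc_lt_succ).le)
  have h4 := Submodule.eq_of_le_of_finrank_le h3 (h1.trans h2)
  rw [← h4]
  exact inf_le_left

lemma DoubleBox.lt (hdb : DoubleBox n w) (i : Fin n) (hi : (i : ℕ) < n / 2) :
    w i.rev < w i :=
  (hdb (i + 1) (by omega) (by omega) (by omega) (by omega)).1

lemma DoubleBox.le_of_lt (hdb : DoubleBox n w) (i a : Fin n) (hi : (i : ℕ) < n / 2)
    (h1 : i ≤ a) (h2 : a ≤ i.rev) (h3 : w i.rev < w a) : w i ≤ w a := by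
  by_contra! h4
  obtain ⟨b, hb1, hb2, hb⟩ :=
    (hdb (i + 1) (by omega) (by omega) (by omega) (by omega)).2 (w a) h3 h4
  rw [Fin.le_def] at h1
  rw [Fin.le_def, Fin.val_rev] at h2
  rcases hb (by omega) (by omega) with h | h
  · have := congrArg Fin.val (w.injective (Fin.ext h))
    simp only at this
    omega
  · have := congrArg Fin.val (w.injective (Fin.ext h))
    simp only at this
    omega

/-- One step of the construction: the next space of the flag contains an isotropic vector
supported on the two coordinates `w(i)` and `w(rev i)`. -/
lemma exists_isotropic_pair_mem (hdb : DoubleBox n w) (hiso : IsotropicFlag n F)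
    (hS : InSchubert n w F) {D : Fin n → ℂ} (i : Fin n) (hi : (i : ℕ) < n / 2)
    (hD0 : ∀ a : Fin n, i ≤ a → D a = 0) (hD1 : ∀ a : Fin n, a < i → D a * D a = -1)
    (hmem : ∀ a : Fin n, a < i → pairedVec w D a ∈ F.V a.succ) :
    ∃ c : ℂ, c * c = -1 ∧
      c • (Pi.single (w i.rev) (1 : ℂ) : Fin n → ℂ) + Pi.single (w i) (1 : ℂ) ∈ F.V i.succ := by
  have hr : (i.rev : ℕ) = n - (i + 1) := Fin.val_rev i
  have hD := mul_rev_eq_zero hi.le hD0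
  have hrev : i < i.rev := by rw [Fin.lt_def]; omega
  obtain ⟨v, hv, hvk, hvn⟩ := hS.exists_mem_notMem i hD
    (fun a ha => hD0 _ (by rw [Fin.lt_def] at ha; rw [Fin.le_def, Fin.val_rev]; omega)) hmem
  have hVr : F.V i.rev.succ = Submodule.span ℂ (pairedVec w D '' {a | (a : ℕ) < n - i}) := by
    have := hiso.eq_span_pairedVec hD hi.le hD1 hmem (by omega)
    rw [← this]
    congr 1
    ext
    simp only [Fin.val_succ]
    omega
  have hVi : F.V i.castSucc = _ :=
    CompleteFlag.eq_span_pairedVec hD i.castSucc.isLt (fun a ha => hmem a ha)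
  have hortho : F.V i.rev.castSucc = bOrtho n (F.V i.succ) := by
    have h := hiso (i + 1) (by omega) (by omega) (by omega) (by omega)
    exact (congrArg F.V (Fin.ext hr)).trans h
  have hvr : v ∈ F.V i.rev.succ :=
    F.mono (by rw [Fin.le_def, Fin.val_succ, Fin.val_succ]; omega) hv
  rw [hVr, mem_span_pairedVec_iff w hD] at hvr
  have hmid : ∀ a : Fin n, i ≤ a → a ≤ i.rev →
      pairedVec w D a = Pi.single (w a) 1 ∧ pairedCoord w D a v = v (w a) := by
    intro a h1 h2
    have h3 : i ≤ a.rev := by rwa [Fin.le_rev_iff]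
    simp [pairedVec, pairedCoord_apply, hD0 a h1, hD0 a.rev h3]
  have hlow : ∀ a : Fin n, i ≤ a → a ≤ i.rev → w a < w i.rev → v (w a) = 0 := by
    intro a h1 h2 h3
    have hB : (Pi.single (w a) 1 : Fin n → ℂ) ∈ F.V i.rev.castSucc := by
      refine hS.inf_stdE_le i hi hD hD0 hVr ⟨?_, ?_⟩
      · rw [hVr, ← (hmid a h1 h2).1]
        refine Submodule.subset_span ⟨a, ?_, rfl⟩
        rw [Fin.le_def] at h2
        change (a : ℕ) < n - i
        omega
      · refine (mem_stdE_iff _).2 fun b hb => ?_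
        rw [Pi.single_eq_of_ne]
        rintro rfl
        rw [Fin.lt_def] at h3
        omega
    rw [hortho] at hB
    simpa [Pi.single_apply] using hB v hv
  have hzero : ∀ a : Fin n, i < a → a < i.rev → v (w a) = 0 := by
    intro a h1 h2
    rcases lt_trichotomy (w a) (w i.rev) with h | h | h
    · exact hlow a h1.le h2.le h
    · exact absurd (w.injective h) h2.ne
    · refine hvk _ (lt_of_le_of_ne (hdb.le_of_lt i a hi h1.le h2.le h) ?_)
      exact fun h => h1.ne (w.injective h)
  let u : Fin n → ℂ := v (w i.rev) • Pi.single (w i.rev) 1 + v (w i) • Pi.single (w i) 1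
  have hvu : v - u ∈ F.V i.castSucc := by
    rw [hVi, mem_span_pairedVec_iff w hD]
    intro a ha
    have ha' : i ≤ a := not_lt.1 ha
    have hu : u = v (w i.rev) • pairedVec w D i.rev + v (w i) • pairedVec w D i := by
      rw [(hmid i le_rfl hrev.le).1, (hmid i.rev hrev.le le_rfl).1]
    rw [map_sub, hu, map_add, map_smul, map_smul, pairedCoord_pairedVec w hD,
      pairedCoord_pairedVec w hD]
    rcases ha'.eq_or_lt with rfl | h1
    · simp [(hmid i le_rfl hrev.le).2, hrev.ne]
    rcases lt_trichotomy a i.rev with h2 | rfl | h2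
    · simp [(hmid a ha' h2.le).2, h1.ne', h2.ne, hzero a h1 h2]
    · simp [(hmid i.rev hrev.le le_rfl).2, hrev.ne']
    · rw [hvr a (by rw [Fin.lt_def] at h2; omega)]
      simp [h1.ne', h2.ne']
  have huV : u ∈ F.V i.succ := by
    have := Submodule.sub_mem _ hv (F.mono (Fin.castSucc_lt_succ).le hvu)
    simpa using this
  have hu0 : u ≠ 0 := by
    intro h
    rw [h, sub_zero] at hvu
    exact hvn hvu
  have hne : w i ≠ w i.rev := fun h => hrev.ne (w.injective h)
  have huu : v (w i.rev) * v (w i.rev) + v (w i) * v (w i) = 0 := by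
    have h1 : u ∈ bOrtho n (F.V i.succ) := by
      rw [← hortho]
      exact F.mono (by rw [Fin.le_def, Fin.val_succ, Fin.val_castSucc]; omega) huV
    have := h1 u huV
    simpa [u, Pi.single_apply, mul_add, Finset.sum_add_distrib, hne, hne.symm] using this
  have hk : v (w i) ≠ 0 := by
    intro h
    apply hu0
    have : v (w i.rev) = 0 := by simpa [h] using huu
    simp [u, h, this]
  refine ⟨v (w i.rev) / v (w i), ?_, ?_⟩
  · field_simp
    linear_combination huu
  · have := Submodule.smul_mem _ (v (w i))⁻¹ huV
    simpa [u, smul_smul, hk, div_eq_inv_mul] using this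

/-- An isotropic flag in the Schubert variety is spanned, in its lower half, by isotropic
paired vectors. -/
lemma exists_pairedVec_mem (hdb : DoubleBox n w) (hiso : IsotropicFlag n F)
    (hS : InSchubert n w F) (i : ℕ) (hi : i ≤ n / 2) :
    ∃ D : Fin n → ℂ, (∀ a : Fin n, i ≤ (a : ℕ) → D a = 0) ∧
      (∀ a : Fin n, (a : ℕ) < i → D a * D a = -1) ∧
      ∀ a : Fin n, (a : ℕ) < i → pairedVec w D a ∈ F.V a.succ := by
  induction i with
  | zero => exact ⟨0, by simp, by simp, by simp⟩
  | succ i ih =>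
    obtain ⟨D, hD0, hD1, hmem⟩ := ih (by omega)
    let i' : Fin n := ⟨i, by omega⟩
    obtain ⟨c, hc, hcmem⟩ := exists_isotropic_pair_mem hdb hiso hS i' hi hD0 hD1 hmem
    have hupd : ∀ a : Fin n, (a : ℕ) ≠ i → Function.update D i' c a = D a := fun a ha =>
      Function.update_of_ne (fun h => ha (congrArg Fin.val h)) _ _
    refine ⟨Function.update D i' c, ?_, ?_, ?_⟩
    · intro a ha
      rw [hupd a (by omega)]
      exact hD0 a (by omega)
    · intro a ha
      by_cases h : (a : ℕ) = i
      · obtain rfl : a = i' := Fin.ext h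
        simpa using hc
      · rw [hupd a h]
        exact hD1 a (by omega)
    · intro a ha
      by_cases h : (a : ℕ) = i
      · obtain rfl : a = i' := Fin.ext h
        simpa [pairedVec] using hcmem
      · rw [pairedVec, hupd a h]
        exact hmem a (by omega)

lemma InSchubert.of_eq_span {D : Fin n → ℂ} (hD : ∀ a, D a * D a.rev = 0)
    (hlt : ∀ a, D a ≠ 0 → w a.rev < w a)
    (hV : ∀ (p : ℕ) (hp : p < n + 1),
      F.V ⟨p, hp⟩ = Submodule.span ℂ (pairedVec w D '' {a | (a : ℕ) < p})) :
    InSchubert n w F := by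
  intro p j _ _ _ _ hp
  rw [← finrank_span_pairedVec w hD]
  apply Submodule.finrank_mono
  rw [Submodule.span_le]
  rintro _ ⟨a, ⟨ha1, ha2⟩, rfl⟩
  refine ⟨?_, (mem_stdE_iff _).2 fun b hb => ?_⟩
  · rw [hV]
    exact Submodule.subset_span ⟨a, ha1, rfl⟩
  · have h1 : b ≠ w a := by rintro rfl; omega
    by_cases h : D a = 0
    · simp [pairedVec, h, h1]
    · have h2 := hlt a h
      have h3 : b ≠ w a.rev := by rintro rfl; rw [Fin.lt_def] at h2; omega
      simp [pairedVec, h1, h3]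

lemma image_uVec_eq (ε : ℕ → ℂ) (D : Fin n → ℂ)
    (hDε : ∀ a : Fin n, D a = if (a : ℕ) < n / 2 then ε (a + 1) * Complex.I else 0)
    {p : ℕ} (hp : p ≤ n) :
    uVec n w ε '' {j | 1 ≤ j ∧ j ≤ p} = pairedVec w D '' {a | (a : ℕ) < p} := by
  have key : ∀ a : Fin n, uVec n w ε (a + 1) = pairedVec w D a := by
    intro a
    have h1 : (⟨n - (a + 1), by omega⟩ : Fin n) = a.rev := Fin.ext (Fin.val_rev a).symm
    rw [uVec, dif_pos ⟨by omega, by omega⟩, pairedVec, hDε, h1]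
    by_cases h : (a : ℕ) < n / 2
    · simp [h, Nat.succ_le_iff.2 h]
    · simp [h, show ¬ ((a : ℕ) + 1 ≤ n / 2) by omega]
  ext x
  constructor
  · rintro ⟨j, ⟨hj1, hj2⟩, rfl⟩
    refine ⟨⟨j - 1, by omega⟩, ?_, ?_⟩
    · change j - 1 < p
      omega
    · rw [← key]
      congr 1
      change j - 1 + 1 = j
      omega
  · rintro ⟨a, ha, rfl⟩
    exact ⟨a + 1, ⟨by omega, ha⟩, key a⟩

end Flag

/-- If `w` satisfies the double box contraction condition, then a complete
flag `V` is isotropic and lies in `S_w` iff there are signs `ε_1,…,ε_m ∈ {1,-1}` such that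
`V_p = span(u_1,…,u_p)` for all `p ≤ n`, where `u_j = ε_j • 𝐢 • e_{w(n+1-j)} + e_{w(j)}` for
`j ≤ m = ⌊n/2⌋` and `u_j = e_{w(j)}` for `m < j ≤ n` (which is `e_{l_*}` for the middle index
and `u_{n+1-j} = e_{l_j}` for the upper indices). -/
theorem isotropic_in_schubert_iff_intersection_point
    (n : ℕ) (hn : 0 < n) (w : Equiv.Perm (Fin n)) (hdb : DoubleBox n w)
    (F : CompleteFlag n) :
    (IsotropicFlag n F ∧ InSchubert n w F) ↔
      ∃ ε : ℕ → ℂ, (∀ j, 1 ≤ j → j ≤ n / 2 → ε j = 1 ∨ ε j = -1) ∧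
        ∀ (p : ℕ) (hp : p < n + 1),
          F.V ⟨p, hp⟩ = Submodule.span ℂ (uVec n w ε '' {j : ℕ | 1 ≤ j ∧ j ≤ p}) := by
  constructor
  · rintro ⟨hiso, hS⟩
    obtain ⟨D, hD0, hD1, hmem⟩ := exists_pairedVec_mem hdb hiso hS (n / 2) le_rfl
    have hD := mul_rev_eq_zero le_rfl hD0
    let ε : ℕ → ℂ := fun j => if h : j - 1 < n then -(D ⟨j - 1, h⟩ * Complex.I) else 1
    have hε : ∀ a : Fin n, ε (a + 1) = -(D a * Complex.I) := fun a => by simp [ε]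
    refine ⟨ε, fun j hj1 hj2 => ?_, fun p hp => ?_⟩
    · have h := hε ⟨j - 1, by omega⟩
      have h1 := hD1 ⟨j - 1, by omega⟩ (by change j - 1 < n / 2; omega)
      rw [show ((⟨j - 1, by omega⟩ : Fin n) : ℕ) + 1 = j from Nat.sub_add_cancel hj1] at h
      rw [h, ← mul_self_eq_one_iff]
      linear_combination Complex.I * Complex.I * h1 - Complex.I_mul_I
    · rw [image_uVec_eq ε D _ (by omega)]
      · rcases le_or_gt p (n / 2) with h | h
        · exact CompleteFlag.eq_span_pairedVec hD hp fun a ha => hmem a (by omega)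
        · obtain ⟨q, hq, rfl⟩ : ∃ q, q ≤ n / 2 ∧ p = n - q := ⟨n - p, by omega, by omega⟩
          exact hiso.eq_span_pairedVec hD hq (fun a ha => hD1 a (by omega))
            (fun a ha => hmem a (by omega)) hp
      · intro a
        split_ifs with h
        · rw [hε]
          linear_combination D a * Complex.I_mul_I
        · exact hD0 a (by omega)
  · rintro ⟨ε, hε, hV⟩
    let D : Fin n → ℂ := fun a => if (a : ℕ) < n / 2 then ε (a + 1) * Complex.I else 0
    have hD0 : ∀ a : Fin n, n / 2 ≤ (a : ℕ) → D a = 0 := fun a ha => if_neg (by omega)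
    have hD1 : ∀ a : Fin n, (a : ℕ) < n / 2 → D a * D a = -1 := by
      intro a ha
      simp only [D, if_pos ha]
      rcases hε (a + 1) (by omega) (by omega) with h | h <;> simp [h]
    have hD := mul_rev_eq_zero le_rfl hD0
    have hV' : ∀ (p : ℕ) (hp : p < n + 1),
        F.V ⟨p, hp⟩ = Submodule.span ℂ (pairedVec w D '' {a | (a : ℕ) < p}) := by
      intro p hp
      rw [hV, image_uVec_eq ε D (fun _ => rfl) (by omega)]
    refine ⟨fun i hi1 hi2 h1 h2 => ?_, InSchubert.of_eq_span hD (fun a ha => ?_) hV'⟩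
    · rw [hV', hV', bOrtho_span_pairedVec w hD (by omega) fun a ha => hD1 a (by omega)]
    · exact hdb.lt a (by by_contra h; exact ha (hD0 a (by omega)))

end
end
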